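/- Let A, \dot A (the derivative), and a continuous function g be such that \Pi : [t,T] \to \mathbb{S}^n is C^1 and satisfies the Lyapunov equation \dot\Pi(s) + \Pi(s)A(s) + A(s)^T\Pi(s) + C(s)^T\Pi(s)C(s) + Q(s) = 0 with \Pi(T) = G, where Q(s) \succeq 0 for all s and G \succeq 0. Then \Pi(s) \succeq 0 for all s \in [t,T] and |\Pi(s)| \le (|G| + T\|Q\|_\infty) e^{T\|A + A^T + C^T C\|_\infty}. -/

import Mathlib

open Matrix

attribute [local instance] Matrix.normedAddCommGroup Matrix.normedSpace

/-- The ℓ²-operator (spectral) norm of a real matrix. -/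
noncomputable def matOpNorm {m n : ℕ} (M : Matrix (Fin m) (Fin n) ℝ) : ℝ :=
  ‖LinearMap.toContinuousLinearMap (Matrix.toEuclideanLin M)‖

theorem aux_unique {R : Type*} [NormedRing R] [NormedAlgebra ℝ R] (t T : ℝ)
    (A B C D N : ℝ → R) (hA : ContinuousOn A (Set.Icc t T)) (hB : ContinuousOn B (Set.Icc t T))
    (hC : ContinuousOn C (Set.Icc t T)) (hD : ContinuousOn D (Set.Icc t T))
    (hN : ∀ s ∈ Set.Icc t T, HasDerivAt N (-(N s * A s + B s * N s + D s * N s * C s)) s)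
    (hT : N T = 0) : ∀ s ∈ Set.Icc t T, N s = 0 := by
  obtain ⟨a, ha⟩ := isCompact_Icc.exists_bound_of_continuousOn hA
  obtain ⟨b, hb⟩ := isCompact_Icc.exists_bound_of_continuousOn hB
  obtain ⟨c, hc⟩ := isCompact_Icc.exists_bound_of_continuousOn hC
  obtain ⟨d, hd⟩ := isCompact_Icc.exists_bound_of_continuousOn hD
  have key : Set.EqOn N (fun _ => (0 : R)) (Set.Icc t T) := by
    refine ODE_solution_unique_of_mem_Icc_left
      (v := fun s X => -(X * A s + B s * X + D s * X * C s)) (s := fun _ => Set.univ)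
      (K := Real.toNNReal (a + b + d * c)) ?_ ?_ ?_ ?_ ?_ ?_ ?_ ?_
    · intro s hs
      have hs' : s ∈ Set.Icc t T := Set.Ioc_subset_Icc_self hs
      have h1 := ha s hs'
      have h2 := hb s hs'
      have h3 := hc s hs'
      have h4 := hd s hs'
      refine LipschitzOnWith.of_dist_le_mul fun X _ Y _ => ?_
      have hd0 : 0 ≤ d := (norm_nonneg _).trans h4
      have hc0 : 0 ≤ c := (norm_nonneg _).trans h3
      have hb0 : 0 ≤ b := (norm_nonneg _).trans h2
      have ha0 : 0 ≤ a := (norm_nonneg _).trans h1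
      rw [Real.coe_toNNReal _ (by positivity), dist_eq_norm, dist_eq_norm]
      have e : -(X * A s + B s * X + D s * X * C s) - -(Y * A s + B s * Y + D s * Y * C s)
          = -((X - Y) * A s + B s * (X - Y) + D s * (X - Y) * C s) := by noncomm_ring
      rw [e, norm_neg]
      have i1 : ‖(X - Y) * A s‖ ≤ ‖X - Y‖ * a := (norm_mul_le _ _).trans (by gcongr)
      have i2 : ‖B s * (X - Y)‖ ≤ b * ‖X - Y‖ := (norm_mul_le _ _).trans (by gcongr)
      have i3 : ‖D s * (X - Y) * C s‖ ≤ d * ‖X - Y‖ * c :=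
        (norm_mul_le _ _).trans (by
          gcongr
          exact (norm_mul_le _ _).trans (by gcongr))
      have := norm_add₃_le (a := (X - Y) * A s) (b := B s * (X - Y)) (c := D s * (X - Y) * C s)
      linarith
    · exact fun s hs => (hN s hs).continuousAt.continuousWithinAt
    · exact fun s hs => (hN s (Set.Ioc_subset_Icc_self hs)).hasDerivWithinAt
    · exact fun s hs => Set.mem_univ _
    · exact continuousOn_const
    · intro s hs
      simpa using hasDerivWithinAt_const (c := (0 : R)) s (Set.Iic s)
    · exact fun s hs => Set.mem_univ _
    · exact hT
  exact fun s hs => key hs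

section
attribute [local instance] Matrix.linftyOpNormedRing Matrix.linftyOpNormedAlgebra
theorem aux_unique_mat {n : ℕ} (t T : ℝ)
    (A B C D N : ℝ → Matrix (Fin n) (Fin n) ℝ)
    (hA : ContinuousOn A (Set.Icc t T)) (hB : ContinuousOn B (Set.Icc t T))
    (hC : ContinuousOn C (Set.Icc t T)) (hD : ContinuousOn D (Set.Icc t T))
    (hN : ∀ s ∈ Set.Icc t T, HasDerivAt N (-(N s * A s + B s * N s + D s * N s * C s)) s)
    (hT : N T = 0) : ∀ s ∈ Set.Icc t T, N s = 0 :=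
  aux_unique t T A B C D N hA hB hC hD hN hT
end

/-- the quadratic form as a linear map of the matrix -/
noncomputable def quadL {n : ℕ} (x : Fin n → ℝ) : Matrix (Fin n) (Fin n) ℝ →L[ℝ] ℝ :=
  LinearMap.toContinuousLinearMap
    { toFun := fun M => x ⬝ᵥ M *ᵥ x
      map_add' := fun M N => by rw [add_mulVec, dotProduct_add]
      map_smul' := fun c M => by rw [smul_mulVec, dotProduct_smul]; rfl }

theorem quadL_apply {n : ℕ} (x : Fin n → ℝ) (M : Matrix (Fin n) (Fin n) ℝ) :
    quadL x M = x ⬝ᵥ M *ᵥ x := rfl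

theorem quadL_deriv {n : ℕ} (x : Fin n → ℝ) {P : ℝ → Matrix (Fin n) (Fin n) ℝ}
    {P' : Matrix (Fin n) (Fin n) ℝ} {s : ℝ} (h : HasDerivAt P P' s) :
    HasDerivAt (fun r => x ⬝ᵥ P r *ᵥ x) (x ⬝ᵥ P' *ᵥ x) s :=
  (quadL x).hasFDerivAt.comp_hasDerivAt s h

theorem transpose_deriv {n : ℕ} {P : ℝ → Matrix (Fin n) (Fin n) ℝ}
    {P' : Matrix (Fin n) (Fin n) ℝ} {s : ℝ} (h : HasDerivAt P P' s) :
    HasDerivAt (fun r => (P r)ᵀ) P'ᵀ s :=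
  (LinearMap.toContinuousLinearMap
    (transposeLinearEquiv (Fin n) (Fin n) ℝ ℝ).toLinearMap).hasFDerivAt.comp_hasDerivAt s h

/-- strict comparison -/
theorem strict_pos {n : ℕ} (t T : ℝ)
    (A C R P : ℝ → Matrix (Fin n) (Fin n) ℝ)
    (hP : ∀ s ∈ Set.Icc t T,
      HasDerivAt P (-(P s * A s + (A s)ᵀ * P s + (C s)ᵀ * P s * C s + R s)) s)
    (hsym : ∀ s ∈ Set.Icc t T, (P s)ᵀ = P s)
    (hR : ∀ s ∈ Set.Icc t T, ∀ x : Fin n → ℝ, x ≠ 0 → 0 < x ⬝ᵥ R s *ᵥ x)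
    (hT : ∀ x : Fin n → ℝ, x ≠ 0 → 0 < x ⬝ᵥ P T *ᵥ x) :
    ∀ s ∈ Set.Icc t T, ∀ x : Fin n → ℝ, 0 ≤ x ⬝ᵥ P s *ᵥ x := by
  have hPc : ContinuousOn P (Set.Icc t T) := fun s hs => (hP s hs).continuousAt.continuousWithinAt
  set K : Set (ℝ × (Fin n → ℝ)) := Set.Icc t T ×ˢ Metric.sphere (0 : Fin n → ℝ) 1 with hK
  have hKc : IsCompact K := isCompact_Icc.prod (isCompact_sphere _ _)
  have hf : ContinuousOn (fun p : ℝ × (Fin n → ℝ) => p.2 ⬝ᵥ P p.1 *ᵥ p.2) K := by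
    have h1 : ContinuousOn (fun p : ℝ × (Fin n → ℝ) => P p.1) K :=
      hPc.comp continuousOn_fst (fun p hp => hp.1)
    have h2 : Continuous (fun q : Matrix (Fin n) (Fin n) ℝ × (Fin n → ℝ) => q.2 ⬝ᵥ q.1 *ᵥ q.2) := by
      fun_prop
    exact h2.comp_continuousOn (h1.prodMk continuousOn_snd)
  set S := {p ∈ K | p.2 ⬝ᵥ P p.1 *ᵥ p.2 ≤ 0} with hS
  have hSc : IsCompact S := by
    have := hf.preimage_isClosed_of_isClosed hKc.isClosed (isClosed_Iic (a := (0:ℝ)))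
    exact hKc.of_isClosed_subset this (fun p hp => hp.1)
  -- scaling to the sphere
  have scale : ∀ s ∈ Set.Icc t T, ∀ x : Fin n → ℝ, x ≠ 0 → x ⬝ᵥ P s *ᵥ x ≤ 0 →
      ∃ y, (s, y) ∈ S := by
    intro s hs x hx hle
    refine ⟨‖x‖⁻¹ • x, ⟨⟨hs, ?_⟩, ?_⟩⟩
    · simp [norm_smul, hx]
    · simp only [mulVec_smul, dotProduct_smul, smul_dotProduct, smul_eq_mul]
      have : 0 ≤ ‖x‖⁻¹ := by positivity
      nlinarith [mul_nonneg this this]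
  rcases S.eq_empty_or_nonempty with he | hne
  · intro s hs x
    by_contra hlt
    push Not at hlt
    have hx : x ≠ 0 := by rintro rfl; simp at hlt
    obtain ⟨y, hy⟩ := scale s hs x hx hlt.le
    rw [he] at hy
    exact hy
  exfalso
  obtain ⟨s0, ⟨⟨⟨s, x⟩, hxS, rfl⟩, hmax⟩⟩ :=
    (hSc.image continuous_fst).exists_isGreatest (hne.image _)
  have hs : s ∈ Set.Icc t T := hxS.1.1
  have hx1 : ‖x‖ = 1 := by simpa using hxS.1.2
  have hle : x ⬝ᵥ P s *ᵥ x ≤ 0 := hxS.2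
  have hx0 : x ≠ 0 := by rintro rfl; simp at hx1
  simp only at hmax
  have hsT : s < T := by
    rcases hs.2.lt_or_eq with h | h
    · exact h
    · subst h
      exact absurd (hT x hx0) (not_lt.mpr hle)
  have hpos : ∀ r ∈ Set.Ioc s T, ∀ y : Fin n → ℝ, 0 ≤ y ⬝ᵥ P r *ᵥ y := by
    intro r hr y
    by_contra hlt
    push Not at hlt
    have hy : y ≠ 0 := by rintro rfl; simp at hlt
    obtain ⟨z, hz⟩ := scale r ⟨hs.1.trans hr.1.le, hr.2⟩ y hy hlt.le
    have := hmax ⟨_, hz, rfl⟩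
    exact absurd hr.1 (not_lt.mpr this)
  have hev : ∀ᶠ r in nhdsWithin s (Set.Ioi s), r ∈ Set.Ioc s T :=
    Ioc_mem_nhdsGT hsT
  have hps : ∀ y : Fin n → ℝ, 0 ≤ y ⬝ᵥ P s *ᵥ y := by
    intro y
    have hc := (quadL_deriv y (hP s hs)).continuousAt.tendsto.mono_left
      (nhdsWithin_le_nhds (s := Set.Ioi s))
    exact ge_of_tendsto hc (hev.mono fun r hr => hpos r hr y)
  have hPSD : (P s).PosSemidef := by
    refine PosSemidef.of_dotProduct_mulVec_nonneg ?_ ?_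
    · rw [IsHermitian, conjTranspose_eq_transpose_of_trivial, hsym s hs]
    · intro y; simpa using hps y
  have hq0 : x ⬝ᵥ P s *ᵥ x = 0 := le_antisymm hle (hps x)
  have hPx : P s *ᵥ x = 0 := by
    have := (hPSD.dotProduct_mulVec_zero_iff x).1 (by simpa using hq0)
    exact this
  have hxP : x ᵥ* P s = 0 := by
    rw [← hsym s hs, vecMul_transpose, hPx]
  have hd := quadL_deriv x (hP s hs)
  have hval : x ⬝ᵥ (-(P s * A s + (A s)ᵀ * P s + (C s)ᵀ * P s * C s + R s)) *ᵥ x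
      = -((C s *ᵥ x) ⬝ᵥ P s *ᵥ (C s *ᵥ x) + x ⬝ᵥ R s *ᵥ x) := by
    simp only [neg_mulVec, add_mulVec, dotProduct_neg, dotProduct_add, ← mulVec_mulVec, hPx,
      mulVec_zero, dotProduct_zero]
    rw [dotProduct_mulVec x (P s), hxP, dotProduct_mulVec x (C s)ᵀ, vecMul_transpose]
    simp
  have hneg : x ⬝ᵥ (-(P s * A s + (A s)ᵀ * P s + (C s)ᵀ * P s * C s + R s)) *ᵥ x < 0 := by
    rw [hval]
    linarith [hps (C s *ᵥ x), hR s hs x hx0]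
  have hslope := (hasDerivAt_iff_tendsto_slope.1 hd).mono_left
    (nhdsWithin_mono s (fun r (hr : r ∈ Set.Ioi s) => ne_of_gt hr))
  have : 0 ≤ x ⬝ᵥ (-(P s * A s + (A s)ᵀ * P s + (C s)ᵀ * P s * C s + R s)) *ᵥ x := by
    refine ge_of_tendsto hslope (hev.mono fun r hr => ?_)
    rw [slope_def_field, hq0, sub_zero]
    exact div_nonneg (hpos r hr x) (sub_nonneg.2 hr.1.le)
  linarith

theorem quad_le_opNorm {n : ℕ} (M : Matrix (Fin n) (Fin n) ℝ) (x : Fin n → ℝ) :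
    x ⬝ᵥ M *ᵥ x ≤ matOpNorm M * (x ⬝ᵥ x) := by
  set u : EuclideanSpace ℝ (Fin n) := WithLp.toLp 2 x with hu
  have h1 := (LinearMap.toContinuousLinearMap (Matrix.toEuclideanLin M)).le_opNorm u
  have h2 := real_inner_le_norm u (LinearMap.toContinuousLinearMap (Matrix.toEuclideanLin M) u)
  have h3 : inner ℝ u (LinearMap.toContinuousLinearMap (Matrix.toEuclideanLin M) u)
      = x ⬝ᵥ M *ᵥ x := by
    simp [hu, EuclideanSpace.inner_eq_star_dotProduct, dotProduct_comm]
  have h4 : ‖u‖ * ‖u‖ = x ⬝ᵥ x := by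
    rw [← real_inner_self_eq_norm_mul_norm, EuclideanSpace.inner_eq_star_dotProduct]
    simp [hu]
  rw [h3] at h2
  unfold matOpNorm
  rw [← h4]
  nlinarith [norm_nonneg u]

theorem opNorm_le_of_quad {n : ℕ} (M : Matrix (Fin n) (Fin n) ℝ) (hM : M.PosSemidef) (c : ℝ)
    (hc : 0 ≤ c) (h : ∀ x : Fin n → ℝ, x ⬝ᵥ M *ᵥ x ≤ c * (x ⬝ᵥ x)) : matOpNorm M ≤ c := by
  refine le_of_forall_gt_imp_ge_of_dense fun c' hc' => ?_
  have hc0 : 0 < c' := lt_of_le_of_lt hc hc'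
  refine ContinuousLinearMap.opNorm_le_bound _ hc0.le fun u => ?_
  set x : Fin n → ℝ := WithLp.ofLp u with hx
  have hsymm : Mᵀ = M := by simpa [IsSymm] using hM.1
  set y := M *ᵥ x with hy
  have hL : LinearMap.toContinuousLinearMap (Matrix.toEuclideanLin M) u = WithLp.toLp 2 y := by
    simp [hy, hx, toEuclideanLin_apply]
  have e1 : ‖u‖ * ‖u‖ = x ⬝ᵥ x := by
    rw [← real_inner_self_eq_norm_mul_norm, EuclideanSpace.inner_eq_star_dotProduct]
    simp [hx]
  rw [hL]
  set v : EuclideanSpace ℝ (Fin n) := WithLp.toLp 2 y with hv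
  have e2 : ‖v‖ * ‖v‖ = y ⬝ᵥ y := by
    rw [← real_inner_self_eq_norm_mul_norm, EuclideanSpace.inner_eq_star_dotProduct]
    simp [hv]
  have e3 : inner ℝ u v = y ⬝ᵥ x := by
    simp [hv, hx, EuclideanSpace.inner_eq_star_dotProduct]
  have h0 := hM.dotProduct_mulVec_nonneg (c' • x - y)
  have hxy : x ⬝ᵥ M *ᵥ y = y ⬝ᵥ y := by
    rw [dotProduct_mulVec, ← hsymm, vecMul_transpose]
  simp only [star_trivial, mulVec_sub, mulVec_smul, ← hy, sub_dotProduct, dotProduct_sub,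
    smul_dotProduct, dotProduct_smul, smul_eq_mul, hxy] at h0
  have h1 := h y
  have h2 := real_inner_le_norm u v
  rw [e3] at h2
  rw [dotProduct_comm x y] at h0
  have hyy : 0 ≤ y ⬝ᵥ y := by rw [← e2]; positivity
  have h3 : c' * (y ⬝ᵥ y) ≤ c' * (c' * (y ⬝ᵥ x)) := by nlinarith
  have h4 : y ⬝ᵥ y ≤ c' * (y ⬝ᵥ x) := le_of_mul_le_mul_left h3 hc0
  rw [← e2] at h4
  by_contra hlt
  push Not at hlt
  have hvpos : 0 < ‖v‖ := lt_of_le_of_lt (by positivity) hlt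
  have : ‖v‖ * ‖v‖ ≤ ‖v‖ * (c' * ‖u‖) := by nlinarith
  have := le_of_mul_le_mul_left this hvpos
  linarith

theorem weak_pos {n : ℕ} (t T : ℝ)
    (A C R P : ℝ → Matrix (Fin n) (Fin n) ℝ)
    (hP : ∀ s ∈ Set.Icc t T,
      HasDerivAt P (-(P s * A s + (A s)ᵀ * P s + (C s)ᵀ * P s * C s + R s)) s)
    (hsym : ∀ s ∈ Set.Icc t T, (P s)ᵀ = P s)
    (hR : ∀ s ∈ Set.Icc t T, ∀ x : Fin n → ℝ, 0 ≤ x ⬝ᵥ R s *ᵥ x)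
    (hT : ∀ x : Fin n → ℝ, 0 ≤ x ⬝ᵥ P T *ᵥ x)
    (Ka : ℝ) (hKa : ∀ s ∈ Set.Icc t T, matOpNorm (A s + (A s)ᵀ + (C s)ᵀ * C s) ≤ Ka) :
    ∀ s ∈ Set.Icc t T, ∀ x : Fin n → ℝ, 0 ≤ x ⬝ᵥ P s *ᵥ x := by
  intro s hs x
  have hxx : ∀ y : Fin n → ℝ, y ≠ 0 → 0 < y ⬝ᵥ y := fun y hy => by
    simpa using (dotProduct_star_self_pos_iff (v := y)).2 hy
  have hxx0 : ∀ y : Fin n → ℝ, 0 ≤ y ⬝ᵥ y := fun y => by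
    simpa using dotProduct_star_self_nonneg y
  set ψ : ℝ → ℝ := fun r => Real.exp ((Ka + 1) * (T - r)) with hψ
  have hψd : ∀ r, HasDerivAt ψ (-(Ka + 1) * ψ r) r := by
    intro r
    have h1 : HasDerivAt (fun r => (Ka + 1) * (T - r)) ((Ka + 1) * (-1)) r :=
      ((hasDerivAt_id r).const_sub T).const_mul _
    have := h1.exp
    convert this using 1
    simp only [hψ]; ring
  have key : ∀ ε > 0, 0 ≤ x ⬝ᵥ P s *ᵥ x + ε * (ψ s * (x ⬝ᵥ x)) := by
    intro ε hε
    have := strict_pos t T A C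
      (fun r => R r + (ε * ψ r) • ((Ka + 1) • (1 : Matrix (Fin n) (Fin n) ℝ)
        - (A r + (A r)ᵀ + (C r)ᵀ * C r)))
      (fun r => P r + (ε * ψ r) • (1 : Matrix (Fin n) (Fin n) ℝ)) ?_ ?_ ?_ ?_ s hs x
    · simpa [add_mulVec, dotProduct_add, smul_mulVec, mul_assoc] using this
    · intro r hr
      have h2 := (hP r hr).add (((hψd r).const_mul ε).smul_const (1 : Matrix (Fin n) (Fin n) ℝ))
      refine h2.congr_deriv ?_
      simp only [add_mul, mul_add, smul_mul_assoc, mul_smul_comm, mul_one, one_mul, smul_sub,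
        smul_add, smul_smul]
      module
    · intro r hr
      simp [hsym r hr]
    · intro r hr y hy
      have h1 := hR r hr y
      have h2 := (quad_le_opNorm (A r + (A r)ᵀ + (C r)ᵀ * C r) y).trans
        (mul_le_mul_of_nonneg_right (hKa r hr) (hxx0 y))
      have h3 : 0 < ε * ψ r := mul_pos hε (Real.exp_pos _)
      have h4 := hxx y hy
      rw [add_mulVec, dotProduct_add, smul_mulVec, dotProduct_smul, sub_mulVec, dotProduct_sub,
        smul_mulVec, one_mulVec, dotProduct_smul, smul_eq_mul, smul_eq_mul]
      have : 0 < (ε * ψ r) * ((Ka + 1) * (y ⬝ᵥ y)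
        - y ⬝ᵥ (A r + (A r)ᵀ + (C r)ᵀ * C r) *ᵥ y) := mul_pos h3 (by linarith)
      linarith
    · intro y hy
      have h3 : 0 < ε * ψ T := mul_pos hε (Real.exp_pos _)
      have h4 := mul_pos h3 (hxx y hy)
      rw [add_mulVec, dotProduct_add, smul_mulVec, dotProduct_smul, one_mulVec, smul_eq_mul]
      linarith [hT y]
  by_contra hlt
  push Not at hlt
  set m := ψ s * (x ⬝ᵥ x) with hm
  have hm0 : 0 ≤ m := mul_nonneg (Real.exp_pos _).le (hxx0 x)
  have hk := key (-(x ⬝ᵥ P s *ᵥ x) / (2 * (m + 1))) (div_pos (by linarith) (by linarith))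
  have : -(x ⬝ᵥ P s *ᵥ x) / (2 * (m + 1)) * m ≤ -(x ⬝ᵥ P s *ᵥ x) / 2 := by
    rw [div_mul_eq_mul_div, div_le_div_iff₀ (by linarith) (by norm_num)]
    nlinarith
  linarith

/-- If `Pi₀ : [t,T] → Sⁿ` is `C¹` and satisfies the Lyapunov equation
`Pi₀' + Pi₀ A + Aᵀ Pi₀ + Cᵀ Pi₀ C + Q = 0`, `Pi₀(T) = G`, with `Q(s) ⪰ 0` and `G ⪰ 0`, then
`Pi₀(s) ⪰ 0` and `|Pi₀(s)| ≤ (|G| + T ‖Q‖_∞) exp(T ‖A + Aᵀ + Cᵀ C‖_∞)` on `[t,T]`. -/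
theorem lyapunov_posSemidef_and_bound {n : ℕ} (t T : ℝ) (ht : 0 ≤ t) (htT : t ≤ T)
    (A C : ℝ → Matrix (Fin n) (Fin n) ℝ)
    (hA : ContinuousOn A (Set.Icc t T)) (hC : ContinuousOn C (Set.Icc t T))
    (Q : ℝ → Matrix (Fin n) (Fin n) ℝ) (hQcont : ContinuousOn Q (Set.Icc t T))
    (hQ : ∀ s ∈ Set.Icc t T, (Q s).PosSemidef)
    (G : Matrix (Fin n) (Fin n) ℝ) (hG : G.PosSemidef)
    (Pi₀ : ℝ → Matrix (Fin n) (Fin n) ℝ)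
    (hderiv : ∀ s ∈ Set.Icc t T,
      HasDerivAt Pi₀ (-(Pi₀ s * A s + (A s)ᵀ * Pi₀ s + (C s)ᵀ * Pi₀ s * C s + Q s)) s)
    (hPi₀T : Pi₀ T = G)
    (Ka Kq : ℝ)
    (hKa : ∀ s ∈ Set.Icc t T, matOpNorm (A s + (A s)ᵀ + (C s)ᵀ * C s) ≤ Ka)
    (hKq : ∀ s ∈ Set.Icc t T, matOpNorm (Q s) ≤ Kq) :
    ∀ s ∈ Set.Icc t T, (Pi₀ s).PosSemidef ∧
      matOpNorm (Pi₀ s) ≤ (matOpNorm G + T * Kq) * Real.exp (T * Ka) := by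
  have hsym : ∀ s ∈ Set.Icc t T, (Pi₀ s)ᵀ = Pi₀ s := by
    have hGs : Gᵀ = G := by simpa [IsSymm] using hG.1
    have := aux_unique_mat t T A (fun s => (A s)ᵀ) C (fun s => (C s)ᵀ) (fun s => (Pi₀ s)ᵀ - Pi₀ s)
      hA (continuous_id.matrix_transpose.comp_continuousOn hA) hC
      (continuous_id.matrix_transpose.comp_continuousOn hC) ?_ ?_
    · exact fun s hs => sub_eq_zero.1 (this s hs)
    · intro s hs
      have hQs : (Q s)ᵀ = Q s := by simpa [IsSymm] using (hQ s hs).1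
      have h := (transpose_deriv (hderiv s hs)).sub (hderiv s hs)
      refine h.congr_deriv ?_
      simp only [transpose_neg, transpose_add, transpose_mul, transpose_transpose, hQs]
      noncomm_ring
    · simp [hPi₀T, hGs]
  have hxx0 : ∀ y : Fin n → ℝ, 0 ≤ y ⬝ᵥ y := fun y => by
    simpa using dotProduct_star_self_nonneg y
  have hpos := weak_pos t T A C Q Pi₀ hderiv hsym
    (fun s hs x => by simpa using (hQ s hs).dotProduct_mulVec_nonneg x)
    (fun x => by rw [hPi₀T]; simpa using hG.dotProduct_mulVec_nonneg x) Ka hKa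
  have hKa0 : 0 ≤ Ka := (norm_nonneg _).trans (hKa T ⟨htT, le_rfl⟩)
  have hKq0 : 0 ≤ Kq := (norm_nonneg _).trans (hKq T ⟨htT, le_rfl⟩)
  have hG0 : 0 ≤ matOpNorm G := norm_nonneg _
  have hT0 : 0 ≤ T := ht.trans htT
  set g := matOpNorm G with hg
  set φ : ℝ → ℝ := fun r => (g + (T - r) * Kq) * Real.exp ((T - r) * Ka) with hφ
  have hφd : ∀ r, HasDerivAt φ (-(Ka * φ r + Kq * Real.exp ((T - r) * Ka))) r := by
    intro r
    have h0 : HasDerivAt (fun r => T - r) (-1) r := (hasDerivAt_id r).const_sub T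
    have h1 := ((h0.mul_const Kq).const_add g).mul (h0.mul_const Ka).exp
    refine h1.congr_deriv ?_
    simp only [hφ]; ring
  have hφ0 : ∀ r ∈ Set.Icc t T, 0 ≤ φ r := fun r hr =>
    mul_nonneg (add_nonneg hG0 (mul_nonneg (sub_nonneg.2 hr.2) hKq0)) (Real.exp_pos _).le
  have hup := weak_pos t T A C
    (fun r => φ r • (Ka • (1 : Matrix (Fin n) (Fin n) ℝ) - (A r + (A r)ᵀ + (C r)ᵀ * C r))
      + ((Kq * Real.exp ((T - r) * Ka)) • (1 : Matrix (Fin n) (Fin n) ℝ) - Q r))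
    (fun r => φ r • (1 : Matrix (Fin n) (Fin n) ℝ) - Pi₀ r) ?_ ?_ ?_ ?_ Ka hKa
  · intro s hs
    have hPSD : (Pi₀ s).PosSemidef := by
      refine PosSemidef.of_dotProduct_mulVec_nonneg ?_ ?_
      · rw [IsHermitian, conjTranspose_eq_transpose_of_trivial, hsym s hs]
      · intro y; simpa using hpos s hs y
    refine ⟨hPSD, (opNorm_le_of_quad _ hPSD (φ s) (hφ0 s hs) fun x => ?_).trans ?_⟩
    · have := hup s hs x
      rw [sub_mulVec, dotProduct_sub, smul_mulVec, one_mulVec, dotProduct_smul, smul_eq_mul] at this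
      linarith
    · have : T - s ≤ T := by linarith [hs.1]
      simp only [hφ]
      gcongr
  · intro r hr
    have h2 := ((hφd r).smul_const (1 : Matrix (Fin n) (Fin n) ℝ)).sub (hderiv r hr)
    refine h2.congr_deriv ?_
    simp only [sub_mul, mul_sub, smul_mul_assoc, mul_smul_comm, mul_one, one_mul, smul_sub,
      smul_add, smul_smul]
    module
  · intro r hr
    simp [hsym r hr]
  · intro r hr y
    have h2 := (quad_le_opNorm (A r + (A r)ᵀ + (C r)ᵀ * C r) y).trans
      (mul_le_mul_of_nonneg_right (hKa r hr) (hxx0 y))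
    have h3 := (quad_le_opNorm (Q r) y).trans
      (mul_le_mul_of_nonneg_right (hKq r hr) (hxx0 y))
    have h4 : 1 ≤ Real.exp ((T - r) * Ka) :=
      Real.one_le_exp (mul_nonneg (sub_nonneg.2 hr.2) hKa0)
    have h5 := mul_nonneg (mul_nonneg hKq0 (hxx0 y)) (sub_nonneg.2 h4)
    have h6 := mul_nonneg (hφ0 r hr) (sub_nonneg.2 h2)
    simp only [add_mulVec, dotProduct_add, sub_mulVec, dotProduct_sub,
      smul_mulVec, one_mulVec, dotProduct_smul, smul_eq_mul] at h6 ⊢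
    linarith
  · intro y
    have := quad_le_opNorm G y
    rw [sub_mulVec, dotProduct_sub, smul_mulVec, one_mulVec, dotProduct_smul, smul_eq_mul, hPi₀T]
    simp only [hφ]
    simp
    linarith
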